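/- arXiv:1002.2540 — 2 statements merged into one kernel-verified Lean document; each statement's English description precedes it below -/
import Mathlib

section
/- Let (H, μ, η, δ, ε) be an anti-special commutative Frobenius algebra on a finite-dimensional complex vector space H with dim H ≥ 2. Then the two vectors η(1) and μ(δ(η 1)) in H are linearly independent. -/
open TensorProduct

noncomputable section

variable {H : Type*} [AddCommGroup H] [Module ℂ H]

/-- A commutative Frobenius algebra structure on `H`, given by multiplication `μ`,
unit `η`, comultiplication `δ` and counit `ε`: `μ` is associative and commutative with
unit `η 1`, `δ` is coassociative and cocommutative with counit `ε`, and the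
Frobenius law `(μ ⊗ id)∘(id ⊗ δ) = δ∘μ = (id ⊗ μ)∘(δ ⊗ id)` holds. -/
structure IsCFA (μ : H ⊗[ℂ] H →ₗ[ℂ] H) (η : ℂ →ₗ[ℂ] H)
    (δ : H →ₗ[ℂ] H ⊗[ℂ] H) (ε : H →ₗ[ℂ] ℂ) : Prop where
  assoc : ∀ x y z : H, μ (μ (x ⊗ₜ[ℂ] y) ⊗ₜ[ℂ] z) = μ (x ⊗ₜ[ℂ] μ (y ⊗ₜ[ℂ] z))
  comm : ∀ x y : H, μ (x ⊗ₜ[ℂ] y) = μ (y ⊗ₜ[ℂ] x)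
  unit_left : ∀ x : H, μ (η 1 ⊗ₜ[ℂ] x) = x
  unit_right : ∀ x : H, μ (x ⊗ₜ[ℂ] η 1) = x
  coassoc : ∀ x : H,
    (TensorProduct.assoc ℂ H H H) ((TensorProduct.map δ LinearMap.id) (δ x)) =
      (TensorProduct.map LinearMap.id δ) (δ x)
  cocomm : ∀ x : H, (TensorProduct.comm ℂ H H) (δ x) = δ x
  counit_left : ∀ x : H,
    (TensorProduct.lid ℂ H) ((TensorProduct.map ε LinearMap.id) (δ x)) = x
  counit_right : ∀ x : H,
    (TensorProduct.rid ℂ H) ((TensorProduct.map LinearMap.id ε) (δ x)) = x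
  frob_left : ∀ x y : H,
    (TensorProduct.map μ LinearMap.id)
      ((TensorProduct.assoc ℂ H H H).symm ((TensorProduct.map LinearMap.id δ) (x ⊗ₜ[ℂ] y))) =
      δ (μ (x ⊗ₜ[ℂ] y))
  frob_right : ∀ x y : H,
    (TensorProduct.map LinearMap.id μ)
      ((TensorProduct.assoc ℂ H H H) ((TensorProduct.map δ LinearMap.id) (x ⊗ₜ[ℂ] y))) =
      δ (μ (x ⊗ₜ[ℂ] y))
/-- A CFA is anti-special if, with `c := ε(μ(δ(η 1)))`,
`c • μ(δ x) = ε(μ(δ x)) • μ(δ(η 1))` for all `x`. -/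
def IsAntiSpecial (μ : H ⊗[ℂ] H →ₗ[ℂ] H) (η : ℂ →ₗ[ℂ] H)
    (δ : H →ₗ[ℂ] H ⊗[ℂ] H) (ε : H →ₗ[ℂ] ℂ) : Prop :=
  ∀ x : H, ε (μ (δ (η 1))) • μ (δ x) = ε (μ (δ x)) • μ (δ (η 1))

/-- Multiplying after comultiplying is multiplication by the loop element `μ (δ (η 1))`. -/
theorem IsCFA.mul_comul {μ : H ⊗[ℂ] H →ₗ[ℂ] H} {η : ℂ →ₗ[ℂ] H}
    {δ : H →ₗ[ℂ] H ⊗[ℂ] H} {ε : H →ₗ[ℂ] ℂ} (hF : IsCFA μ η δ ε) (x : H) :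
    μ (δ x) = μ (μ (δ (η 1)) ⊗ₜ[ℂ] x) := by
  have key : ∀ t : H ⊗[ℂ] H,
      μ ((TensorProduct.map LinearMap.id μ) ((TensorProduct.assoc ℂ H H H) (t ⊗ₜ[ℂ] x))) =
        μ (μ t ⊗ₜ[ℂ] x) := by
    intro t
    induction t with
    | zero => simp
    | tmul a b => simp [hF.assoc]
    | add s t hs ht => simp only [TensorProduct.add_tmul, map_add, hs, ht]
  have h := hF.frob_right (η 1) x
  rw [hF.unit_left, TensorProduct.map_tmul, LinearMap.id_apply] at h
  rw [← key, h]

/-- The counit of the loop element of a commutative Frobenius algebra is its dimension. -/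
theorem IsCFA.counit_mul_comul_unit [FiniteDimensional ℂ H]
    {μ : H ⊗[ℂ] H →ₗ[ℂ] H} {η : ℂ →ₗ[ℂ] H}
    {δ : H →ₗ[ℂ] H ⊗[ℂ] H} {ε : H →ₗ[ℂ] ℂ} (hF : IsCFA μ η δ ε) :
    ε (μ (δ (η 1))) = Module.finrank ℂ H := by
  let F : H ⊗[ℂ] (H ⊗[ℂ] H) →ₗ[ℂ] H :=
    (TensorProduct.lid ℂ H).toLinearMap ∘ₗ TensorProduct.map ε LinearMap.id ∘ₗ
      TensorProduct.map μ LinearMap.id ∘ₗ (TensorProduct.assoc ℂ H H H).symm.toLinearMap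
  have htrace : ∀ t : H ⊗[ℂ] H,
      LinearMap.trace ℂ H (F ∘ₗ (TensorProduct.mk ℂ H (H ⊗[ℂ] H)).flip t) = ε (μ t) := by
    intro t
    induction t with
    | zero => simp
    | tmul a b =>
      have h : F ∘ₗ (TensorProduct.mk ℂ H (H ⊗[ℂ] H)).flip (a ⊗ₜ[ℂ] b) =
          (ε ∘ₗ μ ∘ₗ (TensorProduct.mk ℂ H H).flip a).smulRight b := by
        ext x
        simp [F]
      rw [h, LinearMap.trace_smulRight]
      simp [hF.comm a b]
    | add s t hs ht => simp only [map_add, LinearMap.comp_add, hs, ht]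
  have hid : F ∘ₗ (TensorProduct.mk ℂ H (H ⊗[ℂ] H)).flip (δ (η 1)) = LinearMap.id := by
    ext x
    have h := hF.frob_left x (η 1)
    rw [hF.unit_right, TensorProduct.map_tmul, LinearMap.id_apply] at h
    simp [F, h, hF.counit_left]
  rw [← htrace, hid, LinearMap.trace_id]

/-- For an anti-special commutative Frobenius algebra on a
finite-dimensional complex vector space of dimension at least 2, the vectors `η 1`
and `μ (δ (η 1))` are linearly independent. -/
theorem acfa_unit_loop_independent [FiniteDimensional ℂ H]
    (μ : H ⊗[ℂ] H →ₗ[ℂ] H) (η : ℂ →ₗ[ℂ] H) (δ : H →ₗ[ℂ] H ⊗[ℂ] H) (ε : H →ₗ[ℂ] ℂ)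
    (hF : IsCFA μ η δ ε) (hA : IsAntiSpecial μ η δ ε)
    (hdim : 2 ≤ Module.finrank ℂ H) :
    LinearIndependent ℂ ![η 1, μ (δ (η 1))] := by
  have hc : ε (μ (δ (η 1))) ≠ 0 := by
    rw [hF.counit_mul_comul_unit]
    exact_mod_cast (by omega : Module.finrank ℂ H ≠ 0)
  have hloop : μ (δ (η 1)) ≠ 0 := fun h => hc (by rw [h, map_zero])
  rw [LinearIndependent.pair_iff]
  intro a b hab
  have ha : a = 0 := by
    by_contra ha
    have hle : Module.finrank ℂ H ≤ 1 := by
      refine finrank_le_one (μ (δ (η 1))) fun x => ?_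
      have hx : a • x + b • μ (δ x) = 0 := by
        have h := congrArg (fun y => μ (y ⊗ₜ[ℂ] x)) hab
        simpa only [TensorProduct.add_tmul, ← TensorProduct.smul_tmul', map_add, map_smul,
          hF.unit_left, ← hF.mul_comul, TensorProduct.zero_tmul, map_zero] using h
      have hx' : μ (δ x) = ((ε (μ (δ (η 1))))⁻¹ * ε (μ (δ x))) • μ (δ (η 1)) := by
        rw [mul_smul, ← hA x, inv_smul_smul₀ hc]
      refine ⟨-(a⁻¹ * (b * ((ε (μ (δ (η 1))))⁻¹ * ε (μ (δ x))))), ?_⟩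
      rw [neg_smul, mul_smul, mul_smul, ← hx', ← smul_neg, ← eq_neg_of_add_eq_zero_left hx,
        inv_smul_smul₀ ha]
    omega
  subst ha
  rw [zero_smul, zero_add, smul_eq_zero] at hab
  exact ⟨rfl, hab.resolve_right hloop⟩
end
end

section
/- Let (H, μ, η, δ, ε) be an anti-special commutative Frobenius algebra on a finite-dimensional complex vector space H. Then either dim H ≤ 1 or the 'double loop' scalar vanishes: ε(μ(δ(μ(δ(η 1))))) = 0. -/
open TensorProduct

noncomputable section

variable {H : Type*} [AddCommGroup H] [Module ℂ H]

namespace IsCFA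

variable {μ : H ⊗[ℂ] H →ₗ[ℂ] H} {η : ℂ →ₗ[ℂ] H} {δ : H →ₗ[ℂ] H ⊗[ℂ] H} {ε : H →ₗ[ℂ] ℂ}

/-- The comultiplication in terms of a decomposition of `δ (η 1)`. -/
theorem comul_eq_sum (hF : IsCFA μ η δ ε) {S : Finset (H × H)}
    (hS : δ (η 1) = ∑ i ∈ S, i.1 ⊗ₜ[ℂ] i.2) (x : H) :
    δ x = ∑ i ∈ S, μ (x ⊗ₜ[ℂ] i.1) ⊗ₜ[ℂ] i.2 := by
  have h := hF.frob_left x (η 1)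
  rw [hF.unit_right, TensorProduct.map_tmul, hS] at h
  simpa [TensorProduct.tmul_sum] using h.symm

/-- The handle operator is multiplication by the handle element. -/
theorem mul_comul_s18 (hF : IsCFA μ η δ ε) (x : H) :
    μ (δ x) = μ (x ⊗ₜ[ℂ] μ (δ (η 1))) := by
  obtain ⟨S, hS⟩ := TensorProduct.exists_finset (δ (η 1))
  rw [hF.comul_eq_sum hS x, hS]
  simp [TensorProduct.tmul_sum, hF.assoc]

/-- Closing the handle operator computes the trace of the multiplication operator. -/
theorem trace_mul_left [FiniteDimensional ℂ H] (hF : IsCFA μ η δ ε) (x : H) :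
    LinearMap.trace ℂ H (TensorProduct.curry μ x) = ε (μ (δ x)) := by
  obtain ⟨S, hS⟩ := TensorProduct.exists_finset (δ (η 1))
  have key : TensorProduct.curry μ x = ∑ i ∈ S,
      (ε ∘ₗ (TensorProduct.curry μ).flip i.1).smulRight (μ (x ⊗ₜ[ℂ] i.2)) := by
    ext y
    have h := hF.counit_left y
    rw [hF.comul_eq_sum hS y] at h
    conv_lhs => rw [← h]
    simp
  rw [key, hF.comul_eq_sum hS x]
  simp only [map_sum, LinearMap.trace_smulRight]
  refine Finset.sum_congr rfl fun i _ => ?_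
  simp [hF.assoc, hF.comm i.1 i.2]

end IsCFA

/-- For an anti-special commutative Frobenius algebra on a
finite-dimensional complex vector space, either `dim H ≤ 1` or the double-loop scalar
`ε (μ (δ (μ (δ (η 1)))))` vanishes. -/
theorem acfa_double_loop_zero [FiniteDimensional ℂ H]
    (μ : H ⊗[ℂ] H →ₗ[ℂ] H) (η : ℂ →ₗ[ℂ] H) (δ : H →ₗ[ℂ] H ⊗[ℂ] H) (ε : H →ₗ[ℂ] ℂ)
    (hF : IsCFA μ η δ ε) (hA : IsAntiSpecial μ η δ ε) :
    Module.finrank ℂ H ≤ 1 ∨ ε (μ (δ (μ (δ (η 1))))) = 0 := by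
  have htr := hF.trace_mul_left
  have hc : ε (μ (δ (η 1))) = (Module.finrank ℂ H : ℂ) := by
    have hid : TensorProduct.curry μ (η 1) = LinearMap.id := by
      ext x
      exact hF.unit_left x
    rw [← htr, hid, LinearMap.trace_id]
  have hrank : (Module.finrank ℂ H : ℂ) • TensorProduct.curry μ (μ (δ (η 1))) =
      (ε ∘ₗ μ ∘ₗ δ).smulRight (μ (δ (η 1))) := by
    ext x
    have h := hA x
    rw [hc] at h
    simpa [hF.comm _ x, ← hF.mul_comul_s18] using h
  have hD := congrArg (LinearMap.trace ℂ H) hrank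
  rw [map_smul, LinearMap.trace_smulRight, htr] at hD
  simp only [LinearMap.comp_apply, smul_eq_mul] at hD
  refine or_iff_not_imp_right.mpr fun h => ?_
  have h1 : Module.finrank ℂ H = 1 := by exact_mod_cast (mul_eq_right₀ h).mp hD
  exact h1.le
end
end
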